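/- For any number of agents with general additive valuations and any partition matroid (M, F) used as a common constraint, every Max-NSW allocation is a 1/2-EF1 and Pareto optimal feasible allocation. -/

import Mathlib

open Finset

/-- Additive valuation of a bundle: sum of item values. -/
def AddVal {ι : Type*} (v : ι → ℝ) (S : Finset ι) : ℝ := ∑ g ∈ S, v g

/-- An independence system: a hereditary family of finite sets containing ∅. -/
def IndepSystem {ι : Type*} (F : Finset ι → Prop) : Prop :=
  F ∅ ∧ ∀ ⦃C D : Finset ι⦄, C ⊆ D → F D → F C

/-- A matroid: an independence system with the augmentation property. -/
def IsMatroid {ι : Type*} [DecidableEq ι] (F : Finset ι → Prop) : Prop :=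
  IndepSystem F ∧
    ∀ ⦃C D : Finset ι⦄, F C → F D → C.card < D.card → ∃ x ∈ D \ C, F (insert x C)

/-- A feasible allocation: pairwise disjoint bundles, each independent. -/
def Feasible {ι : Type*} {n : ℕ} (F : Finset ι → Prop) (X : Fin n → Finset ι) : Prop :=
  (∀ i, F (X i)) ∧ ∀ i j : Fin n, i ≠ j → Disjoint (X i) (X j)

/-- The set of agents receiving positive utility. -/
noncomputable def posAgents {ι : Type*} {n : ℕ} (v : Fin n → ι → ℝ)
    (X : Fin n → Finset ι) : Finset (Fin n) :=
  Finset.univ.filter (fun i => 0 < AddVal (v i) (X i))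

/-- Nash product over the agents with positive utility. -/
noncomputable def NashPos {ι : Type*} {n : ℕ} (v : Fin n → ι → ℝ)
    (X : Fin n → Finset ι) : ℝ :=
  ∏ i ∈ posAgents v X, AddVal (v i) (X i)

/-- A Max-NSW allocation: feasible; maximizes the number of agents with positive
utility; and subject to that maximizes the Nash product over those agents. -/
def MaxNSW {ι : Type*} {n : ℕ} (F : Finset ι → Prop) (v : Fin n → ι → ℝ)
    (A : Fin n → Finset ι) : Prop :=
  Feasible F A ∧
    (∀ X : Fin n → Finset ι, Feasible F X → (posAgents v X).card ≤ (posAgents v A).card) ∧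
    (∀ X : Fin n → Finset ι, Feasible F X → (posAgents v X).card = (posAgents v A).card →
      NashPos v X ≤ NashPos v A)

/-- α-EF1. -/
def EF1 {ι : Type*} [DecidableEq ι] {n : ℕ} (α : ℝ) (v : Fin n → ι → ℝ)
    (X : Fin n → Finset ι) : Prop :=
  ∀ i j : Fin n, ∃ Z ⊆ X j, Z.card ≤ 1 ∧ AddVal (v i) (X i) ≥ α * AddVal (v i) (X j \ Z)

/-- Pareto optimality. -/
def ParetoOpt {ι : Type*} {n : ℕ} (F : Finset ι → Prop) (v : Fin n → ι → ℝ)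
    (A : Fin n → Finset ι) : Prop :=
  ¬ ∃ X : Fin n → Finset ι, Feasible F X ∧
      (∀ i, AddVal (v i) (A i) ≤ AddVal (v i) (X i)) ∧
      ∃ j, AddVal (v j) (A j) < AddVal (v j) (X j)

/-- A partition matroid: the ground set is partitioned into categories with capacities. -/
def IsPartitionMatroid {ι : Type*} [DecidableEq ι] [Fintype ι] (F : Finset ι → Prop) : Prop :=
  ∃ (ℓ : ℕ) (E : Fin ℓ → Finset ι) (k : Fin ℓ → ℕ),
    (∀ t t' : Fin ℓ, t ≠ t' → Disjoint (E t) (E t')) ∧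
    (Finset.univ.biUnion E = (Finset.univ : Finset ι)) ∧
    (∀ S : Finset ι, F S ↔ ∀ t, (S ∩ E t).card ≤ k t)

theorem addVal_nonneg' {ι : Type*} {v : ι → ℝ} (hv : ∀ g, 0 ≤ v g) (S : Finset ι) :
    0 ≤ AddVal v S := Finset.sum_nonneg (fun g _ => hv g)

theorem mem_posAgents' {ι : Type*} {n : ℕ} (v : Fin n → ι → ℝ) (X : Fin n → Finset ι) (i : Fin n) :
    i ∈ posAgents v X ↔ 0 < AddVal (v i) (X i) := by
  simp [posAgents]

theorem maxNSW_PO {ι : Type*} {n : ℕ} (F : Finset ι → Prop)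
    (v : Fin n → ι → ℝ) (hv : ∀ i g, 0 ≤ v i g)
    (A : Fin n → Finset ι) (hA : MaxNSW F v A) : ParetoOpt F v A := by
  rintro ⟨X, hX, hle, j, hj⟩
  obtain ⟨-, h1, h2⟩ := hA
  have hsub : posAgents v A ⊆ posAgents v X := by
    intro i hi
    rw [mem_posAgents'] at hi ⊢
    exact hi.trans_le (hle i)
  have heq := Finset.eq_of_subset_of_card_le hsub (h1 X hX)
  have hN := h2 X hX (by rw [heq])
  have hjX : j ∈ posAgents v A := by
    rw [heq, mem_posAgents']
    exact (addVal_nonneg' (hv j) _).trans_lt hj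
  have : NashPos v A < NashPos v X := by
    unfold NashPos
    rw [← heq]
    exact Finset.prod_lt_prod (fun i hi => (mem_posAgents' v A i).1 hi) (fun i _ => hle i)
      ⟨j, hjX, hj⟩
  linarith

theorem maxNSW_swap {ι : Type*} {n : ℕ} (F : Finset ι → Prop)
    (v : Fin n → ι → ℝ) (hv : ∀ i g, 0 ≤ v i g)
    (A : Fin n → Finset ι) (hA : MaxNSW F v A) (i j : Fin n) (hij : i ≠ j)
    (X : Fin n → Finset ι) (hX : Feasible F X) (hsame : ∀ l, l ≠ i → l ≠ j → X l = A l)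
    (hgain : AddVal (v i) (A i) < AddVal (v i) (X i)) :
    AddVal (v j) (X j) < AddVal (v j) (A j) ∧
    AddVal (v i) (X i) * AddVal (v j) (X j) ≤ AddVal (v i) (A i) * AddVal (v j) (A j) := by
  have hlt : AddVal (v j) (X j) < AddVal (v j) (A j) := by
    by_contra hcon
    refine maxNSW_PO F v hv A hA ⟨X, hX, fun l => ?_, i, hgain⟩
    by_cases hli : l = i
    · subst hli; exact hgain.le
    by_cases hlj : l = j
    · subst hlj; exact not_lt.1 hcon
    rw [hsame l hli hlj]
  refine ⟨hlt, ?_⟩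
  have hAi := addVal_nonneg' (hv i) (A i)
  have hAj := addVal_nonneg' (hv j) (A j)
  rcases (addVal_nonneg' (hv j) (X j)).eq_or_lt with h0 | hpos
  · rw [← h0, mul_zero]; positivity
  obtain ⟨-, h1, h2⟩ := hA
  have hsub : posAgents v A ⊆ posAgents v X := by
    intro l hl
    rw [mem_posAgents'] at hl ⊢
    by_cases hli : l = i
    · subst hli; exact hl.trans hgain
    by_cases hlj : l = j
    · subst hlj; exact hpos
    rwa [hsame l hli hlj]
  have heq := Finset.eq_of_subset_of_card_le hsub (h1 X hX)
  have hN := h2 X hX (by rw [heq])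
  have hi : i ∈ posAgents v A := by
    rw [heq, mem_posAgents']; linarith
  have hj : j ∈ (posAgents v A).erase i := by
    rw [Finset.mem_erase, heq, mem_posAgents']; exact ⟨hij.symm, hpos⟩
  unfold NashPos at hN
  rw [← heq, ← Finset.mul_prod_erase _ _ hi, ← Finset.mul_prod_erase _ _ hj,
    ← Finset.mul_prod_erase _ _ hi, ← Finset.mul_prod_erase _ _ hj, ← mul_assoc, ← mul_assoc] at hN
  have hc : ∏ x ∈ ((posAgents v A).erase i).erase j, AddVal (v x) (X x) =
      ∏ x ∈ ((posAgents v A).erase i).erase j, AddVal (v x) (A x) := by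
    refine Finset.prod_congr rfl fun x hx => ?_
    simp only [Finset.mem_erase] at hx
    rw [hsame x hx.2.1 hx.1]
  rw [hc] at hN
  refine le_of_mul_le_mul_right hN (Finset.prod_pos fun x hx => ?_)
  simp only [Finset.mem_erase] at hx
  exact (mem_posAgents' v A x).1 hx.2.2

/-- Exchange map: to every item of `T` a set of items of `S` to be given back. -/
theorem exists_exchange {ι : Type*} [DecidableEq ι] [Fintype ι] (F : Finset ι → Prop)
    (hF : IsPartitionMatroid F) (S T : Finset ι) (hS : F S) (hT : F T) :
    ∃ H : ι → Finset ι, (∀ g ∈ T, H g ⊆ S) ∧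
      (∀ g ∈ T, ∀ g' ∈ T, g ≠ g' → Disjoint (H g) (H g')) ∧
      (∀ g ∈ T, F (insert g (S \ H g)) ∧ F (T.erase g ∪ H g)) := by
  obtain ⟨l, E, k, hdisj, hcov, hFS⟩ := hF
  have hc : ∀ g : ι, ∃ t, g ∈ E t := by
    intro g
    have := Finset.mem_univ g
    rw [← hcov] at this
    simpa using this
  choose c hc using hc
  have hu : ∀ g t, g ∈ E t → t = c g := by
    intro g t hg
    by_contra hne
    exact Finset.disjoint_left.1 (hdisj t (c g) hne) hg (hc g)
  have hswap : ∀ (U : Finset ι) (x y : ι), F U → x ∈ U → c x = c y →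
      F (insert y (U.erase x)) := by
    intro U x y hU hx hxy
    rw [hFS] at hU ⊢
    intro t
    refine le_trans ?_ (hU t)
    by_cases hy : y ∈ E t
    · have hxt : x ∈ E t := by
        rw [hu y t hy, ← hxy]; exact hc x
      have hm : x ∈ U ∩ E t := Finset.mem_inter.2 ⟨hx, hxt⟩
      have : insert y (U.erase x) ∩ E t ⊆ insert y ((U ∩ E t).erase x) := by
        intro z; simp only [Finset.mem_inter, Finset.mem_insert, Finset.mem_erase]; tauto
      calc _ ≤ _ := Finset.card_le_card this
        _ ≤ ((U ∩ E t).erase x).card + 1 := Finset.card_insert_le _ _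
        _ = _ := Finset.card_erase_add_one hm
    · apply Finset.card_le_card
      intro z
      simp only [Finset.mem_inter, Finset.mem_insert, Finset.mem_erase]
      rintro ⟨rfl | h, hz⟩
      · exact absurd hz hy
      · exact ⟨h.2, hz⟩
  have hmap : ∀ t, ∃ f : ι → ι, (T ∩ E t).card ≤ (S ∩ E t).card →
      (∀ g ∈ T ∩ E t, f g ∈ S ∩ E t) ∧ Set.InjOn f (T ∩ E t : Finset ι) := by
    intro t
    by_cases h : (T ∩ E t).card ≤ (S ∩ E t).card
    · obtain ⟨e⟩ : Nonempty ((T ∩ E t : Finset ι) ↪ (S ∩ E t : Finset ι)) :=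
        Function.Embedding.nonempty_of_card_le (by rw [Fintype.card_coe, Fintype.card_coe]; exact h)
      refine ⟨fun g => if hg : g ∈ T ∩ E t then (e ⟨g, hg⟩ : ι) else g, fun _ => ⟨?_, ?_⟩⟩
      · intro g hg
        simp only [dif_pos hg]
        exact (e ⟨g, hg⟩).2
      · intro x hx y hy hxy
        rw [Finset.mem_coe] at hx hy
        simp only [dif_pos hx, dif_pos hy] at hxy
        have := e.injective (Subtype.ext hxy)
        exact congrArg Subtype.val this
    · exact ⟨id, fun h' => absurd h' h⟩
  choose f hf using hmap
  refine ⟨fun g => if (T ∩ E (c g)).card ≤ (S ∩ E (c g)).card then {f (c g) g} else ∅, ?_, ?_, ?_⟩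
  · intro g hg
    dsimp only
    split_ifs with h
    · have := (hf _ h).1 g (Finset.mem_inter.2 ⟨hg, hc g⟩)
      simpa using (Finset.mem_inter.1 this).1
    · simp
  · intro g hg g' hg' hne
    dsimp only
    split_ifs with h h'
    · rw [Finset.disjoint_singleton]
      intro he
      have m1 := (hf _ h).1 g (Finset.mem_inter.2 ⟨hg, hc g⟩)
      have m2 := (hf _ h').1 g' (Finset.mem_inter.2 ⟨hg', hc g'⟩)
      have e1 := hu _ _ (Finset.mem_inter.1 m1).2
      have e2 := hu _ _ (Finset.mem_inter.1 m2).2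
      have e : c g = c g' := by rw [e1, e2, he]
      rw [← e] at he
      refine hne ((hf _ h).2 ?_ ?_ he)
      · exact Finset.mem_coe.2 (Finset.mem_inter.2 ⟨hg, hc g⟩)
      · refine Finset.mem_coe.2 (Finset.mem_inter.2 ⟨hg', ?_⟩)
        rw [e]; exact hc g'
    all_goals simp
  · intro g hg
    dsimp only
    split_ifs with h
    · have m1 := Finset.mem_inter.1 ((hf _ h).1 g (Finset.mem_inter.2 ⟨hg, hc g⟩))
      have e1 := hu _ _ m1.2
      refine ⟨?_, ?_⟩
      · rw [Finset.sdiff_singleton_eq_erase]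
        exact hswap S _ g hS m1.1 e1.symm
      · rw [Finset.union_comm, ← Finset.insert_eq]
        exact hswap T g _ hT hg e1
    · push Not at h
      rw [Finset.sdiff_empty, Finset.union_empty]
      rw [hFS] at hS hT
      refine ⟨(hFS _).2 fun t => ?_, (hFS _).2 fun t => ?_⟩
      · by_cases hgt : g ∈ E t
        · have := hu g t hgt
          subst this
          rw [Finset.insert_inter_of_mem hgt]
          have := Finset.card_insert_le g (S ∩ E (c g))
          have := hT (c g)
          omega
        · rw [Finset.insert_inter_of_notMem hgt]; exact hS t
      · exact le_trans (Finset.card_le_card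
          (Finset.inter_subset_inter_right (Finset.erase_subset _ _))) (hT t)

theorem maxNSW_EF1 {ι : Type*} [DecidableEq ι] [Fintype ι] {n : ℕ}
    (F : Finset ι → Prop) (hF : IsPartitionMatroid F)
    (v : Fin n → ι → ℝ) (hv : ∀ i g, 0 ≤ v i g)
    (A : Fin n → Finset ι) (hA : MaxNSW F v A) : EF1 (1/2) v A := by
  intro i j
  have hVi := addVal_nonneg' (hv i) (A i)
  by_cases hij : i = j
  · subst hij
    exact ⟨∅, by simp, by simp, by rw [Finset.sdiff_empty]; linarith⟩
  obtain ⟨H, hH1, hH2, hH3⟩ := exists_exchange F hF (A i) (A j) (hA.1.1 i) (hA.1.1 j)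
  have hAd := hA.1.2
  have key : ∀ g ∈ A j, 0 < v i g - AddVal (v i) (H g) →
      0 < v j g - AddVal (v j) (H g) ∧
      (AddVal (v i) (A i) + (v i g - AddVal (v i) (H g))) *
        (AddVal (v j) (A j) - (v j g - AddVal (v j) (H g))) ≤
        AddVal (v i) (A i) * AddVal (v j) (A j) := by
    intro g hg ha
    have hgi : g ∉ A i := fun h => Finset.disjoint_left.1 (hAd i j hij) h hg
    let X : Fin n → Finset ι := fun l =>
      if l = i then insert g (A i \ H g) else if l = j then (A j).erase g ∪ H g else A l
    have hXi : X i = insert g (A i \ H g) := by simp [X]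
    have hXj : X j = (A j).erase g ∪ H g := by simp [X, Ne.symm hij]
    have hXo : ∀ l, l ≠ i → l ≠ j → X l = A l := by
      intro l h1 h2; simp [X, h1, h2]
    have hHj : Disjoint ((A j).erase g) (H g) := by
      refine Finset.disjoint_left.2 fun x hx hx' => ?_
      exact Finset.disjoint_left.1 (hAd i j hij) (hH1 g hg hx') (Finset.mem_of_mem_erase hx)
    have hvi : AddVal (v i) (X i) = AddVal (v i) (A i) + (v i g - AddVal (v i) (H g)) := by
      rw [hXi]
      unfold AddVal
      rw [Finset.sum_insert (by simp [hgi])]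
      have := Finset.sum_sdiff (f := v i) (hH1 g hg)
      linarith
    have hvj : AddVal (v j) (X j) = AddVal (v j) (A j) - (v j g - AddVal (v j) (H g)) := by
      rw [hXj]
      unfold AddVal
      rw [Finset.sum_union hHj]
      have := Finset.sum_erase_add (A j) (v j) hg
      linarith
    have hsubi : ∀ x ∈ X i, x ∈ A i ∨ x ∈ A j := by
      intro x hx
      rw [hXi, Finset.mem_insert, Finset.mem_sdiff] at hx
      rcases hx with rfl | hx
      · exact Or.inr hg
      · exact Or.inl hx.1
    have hsubj : ∀ x ∈ X j, x ∈ A i ∨ x ∈ A j := by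
      intro x hx
      rw [hXj, Finset.mem_union, Finset.mem_erase] at hx
      rcases hx with hx | hx
      · exact Or.inr hx.2
      · exact Or.inl (hH1 g hg hx)
    have hdij : Disjoint (X i) (X j) := by
      rw [hXi, hXj]
      refine Finset.disjoint_left.2 fun x hx hx' => ?_
      rw [Finset.mem_insert, Finset.mem_sdiff] at hx
      rw [Finset.mem_union, Finset.mem_erase] at hx'
      rcases hx with rfl | hx
      · rcases hx' with hx' | hx'
        · exact hx'.1 rfl
        · exact hgi (hH1 _ hg hx')
      · rcases hx' with hx' | hx'
        · exact Finset.disjoint_left.1 (hAd i j hij) hx.1 hx'.2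
        · exact hx.2 hx'
    have hdo : ∀ l, l ≠ i → l ≠ j → ∀ x, (x ∈ A i ∨ x ∈ A j) → x ∉ X l := by
      intro l h1 h2 x hx hxl
      rw [hXo l h1 h2] at hxl
      rcases hx with hx | hx
      · exact Finset.disjoint_left.1 (hAd l i h1) hxl hx
      · exact Finset.disjoint_left.1 (hAd l j h2) hxl hx
    have hX : Feasible F X := by
      constructor
      · intro l
        by_cases h1 : l = i
        · subst h1; rw [hXi]; exact (hH3 g hg).1
        by_cases h2 : l = j
        · subst h2; rw [hXj]; exact (hH3 g hg).2
        rw [hXo l h1 h2]; exact hA.1.1 l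
      · intro l m hlm
        have hin : ∀ p, p = i ∨ p = j → ∀ x ∈ X p, x ∈ A i ∨ x ∈ A j := by
          rintro p (rfl | rfl)
          · exact hsubi
          · exact hsubj
        by_cases hl : l = i ∨ l = j
        · by_cases hm : m = i ∨ m = j
          · rcases hl with rfl | rfl <;> rcases hm with rfl | rfl
            · exact absurd rfl hlm
            · exact hdij
            · exact hdij.symm
            · exact absurd rfl hlm
          · push Not at hm
            exact Finset.disjoint_left.2 fun x hx => hdo m hm.1 hm.2 x (hin l hl x hx)
        · push Not at hl
          by_cases hm : m = i ∨ m = j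
          · exact Finset.disjoint_right.2 fun x hx => hdo l hl.1 hl.2 x (hin m hm x hx)
          · push Not at hm
            rw [hXo l hl.1 hl.2, hXo m hm.1 hm.2]
            exact hAd l m hlm
    have := maxNSW_swap F v hv A hA i j hij X hX hXo (by rw [hvi]; linarith)
    rw [hvi, hvj] at this
    exact ⟨by linarith [this.1], this.2⟩
  set a : ι → ℝ := fun g => v i g - AddVal (v i) (H g) with ha
  set b : ι → ℝ := fun g => v j g - AddVal (v j) (H g) with hb
  set P := (A j).filter (fun g => 0 < a g) with hP
  have hHs : ∑ g ∈ A j, AddVal (v i) (H g) ≤ AddVal (v i) (A i) := by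
    unfold AddVal
    rw [← Finset.sum_biUnion (fun x hx y hy hxy => hH2 x hx y hy hxy)]
    exact Finset.sum_le_sum_of_subset_of_nonneg (Finset.biUnion_subset.2 hH1)
      (fun x _ _ => hv i x)
  have hsplit : AddVal (v i) (A j) = ∑ g ∈ A j, a g + ∑ g ∈ A j, AddVal (v i) (H g) := by
    rw [← Finset.sum_add_distrib]
    exact Finset.sum_congr rfl fun g _ => by simp [ha]
  have haP : ∑ g ∈ A j, a g ≤ ∑ g ∈ P, a g := by
    rw [hP, Finset.sum_filter]
    refine Finset.sum_le_sum fun g _ => ?_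
    split_ifs with h
    · exact le_rfl
    · exact not_lt.1 h
  rcases P.eq_empty_or_nonempty with hPe | hPn
  · refine ⟨∅, by simp, by simp, ?_⟩
    rw [hPe, Finset.sum_empty] at haP
    rw [Finset.sdiff_empty]
    linarith
  obtain ⟨m, hm, hmax⟩ := Finset.exists_max_image P a hPn
  have hmj : m ∈ A j ∧ 0 < a m := by simpa [hP] using hm
  refine ⟨{m}, by simpa using hmj.1, by simp, ?_⟩
  have hbP : ∑ g ∈ P, b g ≤ AddVal (v j) (A j) := by
    calc ∑ g ∈ P, b g ≤ ∑ g ∈ P, v j g :=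
          Finset.sum_le_sum fun g _ => by
            have := addVal_nonneg' (hv j) (H g)
            simp only [hb]; linarith
      _ ≤ _ := Finset.sum_le_sum_of_subset_of_nonneg (Finset.filter_subset _ _)
          (fun x _ _ => hv j x)
  have hterm : ∀ g ∈ P, a g * AddVal (v j) (A j) ≤ b g * (AddVal (v i) (A i) + a m) := by
    intro g hg
    have hg' : g ∈ A j ∧ 0 < a g := by simpa [hP] using hg
    obtain ⟨h1, h2⟩ := key g hg'.1 hg'.2
    change 0 < b g at h1
    change (_ + a g) * (_ - b g) ≤ _ at h2
    have h3 := mul_le_mul_of_nonneg_left (hmax g hg) h1.le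
    nlinarith
  have hsum := Finset.sum_le_sum hterm
  rw [← Finset.sum_mul, ← Finset.sum_mul] at hsum
  have hVj : 0 < AddVal (v j) (A j) :=
    lt_of_lt_of_le (Finset.sum_pos (fun g hg => by
      have hg' : g ∈ A j ∧ 0 < a g := by simpa [hP] using hg
      exact (key g hg'.1 hg'.2).1) hPn) hbP
  have hfin : ∑ g ∈ P, a g ≤ AddVal (v i) (A i) + a m := by
    have h4 := mul_le_mul_of_nonneg_right hbP (by linarith [hmj.2] : 0 ≤ AddVal (v i) (A i) + a m)
    refine le_of_mul_le_mul_right ?_ hVj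
    linarith
  have hrem : AddVal (v i) (A j \ {m}) = AddVal (v i) (A j) - v i m := by
    rw [Finset.sdiff_singleton_eq_erase]
    unfold AddVal
    have := Finset.sum_erase_add (A j) (v i) hmj.1
    linarith
  have ham : a m ≤ v i m := by
    have := addVal_nonneg' (hv i) (H m)
    simp only [ha]; linarith
  rw [hrem]
  linarith

/-- Under partition matroid constraints, with additive (nonnegative)
valuations, every Max-NSW allocation is 1/2-EF1 and Pareto optimal. -/
theorem maxNSW_half_EF1_and_PO_under_partition_matroid
    {ι : Type*} [DecidableEq ι] [Fintype ι] {n : ℕ}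
    (F : Finset ι → Prop) (hF : IsPartitionMatroid F)
    (v : Fin n → ι → ℝ) (hv : ∀ i g, 0 ≤ v i g)
    (A : Fin n → Finset ι) (hA : MaxNSW F v A) :
    EF1 (1/2) v A ∧ ParetoOpt F v A := by
  exact ⟨maxNSW_EF1 F hF v hv A hA, maxNSW_PO F v hv A hA⟩
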